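/- There exist absolute constants C₀ and C₁ such that the following holds. For any constants a > b > C₀ and γ > 0 satisfying (a-b)²/(a+b) ≥ C₁ · log(1/γ), there exists an estimator (a function assigning to each graph on V a pair of disjoint subsets partitioning V) which, applied to a graph drawn from the two-block stochastic block model SBM(n,a,b), outputs a γ-correct partition with probability 1 − o(1) as n → ∞. -/

import Mathlib

open MeasureTheory Filter Finset

/-- The Bernoulli measure on `Bool` with success probability `p` (clamped to `[0,1]`). -/
noncomputable def bern (p : ℝ) : Measure Bool :=
  (PMF.bernoulli (min (Real.toNNReal p) 1) (min_le_right _ _)).toMeasure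

instance (p : ℝ) : IsProbabilityMeasure (bern p) := by
  unfold bern; infer_instance

/-- Index set for the unordered pairs of distinct vertices of `Fin N`. -/
abbrev EdgeIdx (N : ℕ) := {e : Fin N × Fin N // e.1 < e.2}

/-- A configuration of edges: which unordered pairs form an edge. -/
abbrev Config (N : ℕ) := EdgeIdx N → Bool

/-- A colored configuration: for every pair, (edge present, edge Red). For the censor
block model the second component is instead the noise bit of the pair. -/
abbrev CConfig (N : ℕ) := EdgeIdx N → Bool × Bool

/-- Adjacency relation of the graph determined by a configuration. -/
def adjOf {N : ℕ} (ω : Config N) (i j : Fin N) : Bool :=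
  if h : i < j then ω ⟨(i, j), h⟩ else if h : j < i then ω ⟨(j, i), h⟩ else false

/-- Degree of a vertex in the graph determined by a configuration. -/
def degOf {N : ℕ} (ω : Config N) (v : Fin N) : ℕ :=
  (univ.filter fun j => adjOf ω v j).card

/-- The two-block stochastic block model `SBM(n,a,b)` on `2*n` vertices: within-block
pairs are edges with probability `a/n`, cross-block pairs with probability `b/n`,
independently. -/
noncomputable def sbm2 (n : ℕ) (a b : ℝ) : Measure (Config (2 * n)) :=
  Measure.pi fun e =>
    bern (if ((e.1.1 : ℕ) < n ↔ (e.1.2 : ℕ) < n) then a / n else b / n)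

/-- The first block `V₁` (the first `n` vertices). -/
def block1 (n : ℕ) : Finset (Fin (2 * n)) := univ.filter fun i => (i : ℕ) < n

/-- The second block `V₂` (the last `n` vertices). -/
def block2 (n : ℕ) : Finset (Fin (2 * n)) := univ.filter fun i => ¬ (i : ℕ) < n

/-- `(V₁', V₂')` is `γ`-correct: `|Vᵢ ∩ Vᵢ'| ≥ (1-γ)n` for `i = 1,2`. -/
def correct2 (n : ℕ) (γ : ℝ) (P : Finset (Fin (2 * n)) × Finset (Fin (2 * n))) : Prop :=
  (1 - γ) * (n : ℝ) ≤ ((block1 n ∩ P.1).card : ℝ) ∧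
  (1 - γ) * (n : ℝ) ≤ ((block2 n ∩ P.2).card : ℝ)

/-- A pair of disjoint subsets partitioning the vertex set. -/
def isPartition2 {N : ℕ} (P : Finset (Fin N) × Finset (Fin N)) : Prop :=
  Disjoint P.1 P.2 ∧ P.1 ∪ P.2 = univ

/-- Expected adjacency matrix of `SBM(n,a,b)`. -/
noncomputable def expAdj (n : ℕ) (a b : ℝ) : Matrix (Fin (2 * n)) (Fin (2 * n)) ℝ :=
  fun i j => if i = j then 0 else if ((i : ℕ) < n ↔ (j : ℕ) < n) then a / n else b / n

/-- Adjacency matrix (over `ℝ`) of the graph determined by a configuration. -/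
noncomputable def adjMat {N : ℕ} (ω : Config N) : Matrix (Fin N) (Fin N) ℝ :=
  fun i j => if adjOf ω i j then 1 else 0

/-- Zero out all rows and columns corresponding to vertices of degree `> 20 d`. -/
noncomputable def zeroOutHighDeg {N : ℕ} (d : ℝ) (ω : Config N)
    (M : Matrix (Fin N) (Fin N) ℝ) : Matrix (Fin N) (Fin N) ℝ :=
  fun i j => if 20 * d < (degOf ω i : ℝ) ∨ 20 * d < (degOf ω j : ℝ) then 0 else M i j

/-- The spectral (ℓ² operator) norm of a real square matrix. -/
noncomputable def opNorm {N : ℕ} (M : Matrix (Fin N) (Fin N) ℝ) : ℝ :=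
  ‖LinearMap.toContinuousLinearMap (Matrix.toEuclideanLin M)‖

/-- The orthogonal projection onto a subspace, as an endomorphism. -/
noncomputable def projCLM {N : ℕ} (W : Submodule ℝ (EuclideanSpace ℝ (Fin N))) :
    EuclideanSpace ℝ (Fin N) →L[ℝ] EuclideanSpace ℝ (Fin N) :=
  W.subtypeL.comp (Submodule.orthogonalProjection W)

/-- `sin ∠(W₁, W₂) := ‖P_{W₁} - P_{W₂}‖`. -/
noncomputable def sinAngle {N : ℕ} (W₁ W₂ : Submodule ℝ (EuclideanSpace ℝ (Fin N))) : ℝ :=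
  ‖projCLM W₁ - projCLM W₂‖

/-- Build a vector of `EuclideanSpace ℝ (Fin N)` from its coordinates. -/
noncomputable def mkVec {N : ℕ} (f : Fin N → ℝ) : EuclideanSpace ℝ (Fin N) :=
  (EuclideanSpace.equiv (Fin N) ℝ).symm f

/-- `W` is the eigenspace corresponding to the top two eigenvalues of the symmetric
matrix `M`: it is spanned by two orthonormal eigenvectors whose eigenvalues dominate
every eigenvalue attained on `Wᗮ`. -/
def IsTopTwoSpace {N : ℕ} (M : Matrix (Fin N) (Fin N) ℝ)
    (W : Submodule ℝ (EuclideanSpace ℝ (Fin N))) : Prop :=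
  ∃ (u₁ u₂ : EuclideanSpace ℝ (Fin N)) (μ₁ μ₂ : ℝ),
    (inner ℝ u₁ u₂ : ℝ) = 0 ∧ ‖u₁‖ = 1 ∧ ‖u₂‖ = 1 ∧
    W = Submodule.span ℝ {u₁, u₂} ∧
    Matrix.toEuclideanLin M u₁ = μ₁ • u₁ ∧
    Matrix.toEuclideanLin M u₂ = μ₂ • u₂ ∧
    ∀ (μ : ℝ) (v : EuclideanSpace ℝ (Fin N)), v ≠ 0 → v ∈ Wᗮ →
      Matrix.toEuclideanLin M v = μ • v → μ ≤ min μ₁ μ₂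

/-- `P` is a possible output of the **Spectral Partition** algorithm run on the
configuration `ω` with degree parameter `d`. -/
def IsSpectralOutput (n : ℕ) (ω : Config (2 * n)) (d : ℝ)
    (P : Finset (Fin (2 * n)) × Finset (Fin (2 * n))) : Prop :=
  ∃ (W : Submodule ℝ (EuclideanSpace ℝ (Fin (2 * n))))
    (v : EuclideanSpace ℝ (Fin (2 * n))),
    IsTopTwoSpace (zeroOutHighDeg d ω (adjMat ω)) W ∧
    v ∈ W ∧ ‖v‖ = 1 ∧ (inner ℝ (projCLM W (mkVec fun _ => 1)) v : ℝ) = 0 ∧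
    P.1.card = n ∧ P.2 = P.1ᶜ ∧ ∀ i ∈ P.1, ∀ j ∈ P.2, v j ≤ v i

/-- The two-block SBM together with an independent fair Red/Blue coloring of each edge:
first component = edge present, second component = edge colored Red. -/
noncomputable def sbm2c (n : ℕ) (a b : ℝ) : Measure (CConfig (2 * n)) :=
  Measure.pi fun e =>
    (bern (if ((e.1.1 : ℕ) < n ↔ (e.1.2 : ℕ) < n) then a / n else b / n)).prod
      (bern (1 / 2))

/-- The Red subgraph of a colored configuration. -/
def redConf {N : ℕ} (ω : CConfig N) : Config N := fun e => (ω e).1 && (ω e).2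

/-- The Blue subgraph of a colored configuration. -/
def blueConf {N : ℕ} (ω : CConfig N) : Config N := fun e => (ω e).1 && !(ω e).2

/-- Number of Blue neighbors of `u` inside `S`. -/
noncomputable def blueDegIn {N : ℕ} (ω : CConfig N) (S : Finset (Fin N)) (u : Fin N) : ℕ :=
  (S.filter fun v => adjOf (blueConf ω) u v).card

/-- Number of Red neighbors of `u` inside `S`. -/
noncomputable def redDegIn {N : ℕ} (ω : CConfig N) (S : Finset (Fin N)) (u : Fin N) : ℕ :=
  (S.filter fun v => adjOf (redConf ω) u v).card

/-- The **Correction** subroutine with threshold `t`: a vertex of `P.i` is bad if it has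
at least `t` Blue neighbors in the other class; bad vertices are moved to the other side. -/
noncomputable def corrected2 {N : ℕ} (t : ℝ) (ω : CConfig N)
    (P : Finset (Fin N) × Finset (Fin N)) : Finset (Fin N) × Finset (Fin N) :=
  let bad1 := P.1.filter fun u => t ≤ (blueDegIn ω P.2 u : ℝ)
  let bad2 := P.2.filter fun u => t ≤ (blueDegIn ω P.1 u : ℝ)
  ((P.1 \ bad1) ∪ bad2, (P.2 \ bad2) ∪ bad1)

/-- The `k`-block SBM on `k*m` vertices (`k` blocks of size `m`, so `n = k*m` total
vertices and edge probabilities `a/n` within blocks and `b/n` across). -/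
noncomputable def sbmK (k m : ℕ) (a b : ℝ) : Measure (Config (k * m)) :=
  Measure.pi fun e =>
    bern (if (e.1.1 : ℕ) / m = (e.1.2 : ℕ) / m then a / (k * m) else b / (k * m))

/-- The `i`-th block `Vᵢ` (of size `m = n/k`). -/
def blockK (k m : ℕ) (i : Fin k) : Finset (Fin (k * m)) :=
  univ.filter fun v => (v : ℕ) / m = (i : ℕ)

/-- The subset `Z` selected by the splitting coins `s` (its complement is `Y`). -/
def Zset {N : ℕ} (s : Fin N → Bool) : Finset (Fin N) := univ.filter fun v => s v = true

/-- The `k`-block SBM together with a uniformly random split of the vertices. -/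
noncomputable def sbmKs (k m : ℕ) (a b : ℝ) :
    Measure ((Fin (k * m) → Bool) × Config (k * m)) :=
  (Measure.pi fun _ : Fin (k * m) => bern (1 / 2)).prod (sbmK k m a b)

/-- The `k`-block SBM together with a uniformly random split of the vertices and an
independent fair Red/Blue coloring of each edge. -/
noncomputable def sbmKsc (k m : ℕ) (a b : ℝ) :
    Measure ((Fin (k * m) → Bool) × CConfig (k * m)) :=
  (Measure.pi fun _ : Fin (k * m) => bern (1 / 2)).prod
    (Measure.pi fun e : EdgeIdx (k * m) =>
      (bern (if (e.1.1 : ℕ) / m = (e.1.2 : ℕ) / m then a / (k * m) else b / (k * m))).prod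
        (bern (1 / 2)))

/-- `U` is a `γ`-correct partition of `Z = (V₁ ∩ Z) ∪ ... ∪ (V_k ∩ Z)`:
a collection of disjoint subsets of `Z` covering `Z` with
`|(Vᵢ ∩ Z) ∩ Uᵢ| ≥ (1-γ)|Vᵢ ∩ Z|` for every `i`. -/
def correctOnZ (k m : ℕ) (γ : ℝ) (s : Fin (k * m) → Bool)
    (U : Fin k → Finset (Fin (k * m))) : Prop :=
  (∀ i, U i ⊆ Zset s) ∧ (∀ i j, i ≠ j → Disjoint (U i) (U j)) ∧
  (univ.biUnion U = Zset s) ∧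
  ∀ i, (1 - γ) * ((blockK k m i ∩ Zset s).card : ℝ) ≤
    (((blockK k m i ∩ Zset s) ∩ U i).card : ℝ)

/-- Censor block model: for every pair of vertices, an independent pair
(edge present with probability `p`, noise bit with probability `ε`). -/
noncomputable def cbmMeasure (n : ℕ) (p ε : ℝ) : Measure (CConfig (2 * n)) :=
  Measure.pi fun _ => (bern p).prod (bern ε)

/-- The observation `y = B_G x ⊕ z` of the censor block model: for each present edge
`(i,j)` one observes `x_i ⊕ x_j ⊕ z_e` (where `x` is the indicator of the second
block); nothing is observed on absent edges. -/
def cbmObs (n : ℕ) (ω : CConfig (2 * n)) (e : EdgeIdx (2 * n)) : Option Bool :=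
  if (ω e).1 then
    some (xor (xor (decide ((e.1.1 : ℕ) < n)) (decide ((e.1.2 : ℕ) < n))) (ω e).2)
  else none

/-- `e(S,T)`: adjacency-matrix count of edges between `S` and `T` in a simple graph. -/
def eCount {n : ℕ} (G : SimpleGraph (Fin n)) [DecidableRel G.Adj]
    (S T : Finset (Fin n)) : ℝ :=
  ∑ i ∈ S, ∑ j ∈ T, if G.Adj i j then 1 else 0

/-- `e(S,T)` for the graph of a configuration. -/
def eCountC {n : ℕ} (ω : Config n) (S T : Finset (Fin n)) : ℝ :=
  ∑ i ∈ S, ∑ j ∈ T, if adjOf ω i j then 1 else 0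

/-- The random symmetric matrix model: independent edges, pair `(i,j)` present with
probability `p i j`. -/
noncomputable def genMeasure {n : ℕ} (p : Fin n → Fin n → ℝ) : Measure (Config n) :=
  Measure.pi fun e => bern (p e.1.1 e.1.2)

/-- The centered matrix `M` with `M_ij = 1 - p_ij` if the pair is present and
`M_ij = -p_ij` otherwise, and zero diagonal. -/
noncomputable def centeredMat {n : ℕ} (p : Fin n → Fin n → ℝ) (ω : Config n) :
    Matrix (Fin n) (Fin n) ℝ :=
  fun i j => if i = j then 0 else (if adjOf ω i j then 1 else 0) - p i j

/-- Number of positive entries in row `i` of `M`. -/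
noncomputable def posRowCount {n : ℕ} (M : Matrix (Fin n) (Fin n) ℝ) (i : Fin n) : ℕ :=
  (univ.filter fun j => 0 < M i j).card

/-- Zero out the rows and columns indexed by `S`. -/
noncomputable def zeroOutRows {n : ℕ} (S : Finset (Fin n)) (M : Matrix (Fin n) (Fin n) ℝ) :
    Matrix (Fin n) (Fin n) ℝ :=
  fun i j => if i ∈ S ∨ j ∈ S then 0 else M i j

/-- The all-ones direction `v̄₁` (unit vector). -/
noncomputable def vbar1 (n : ℕ) : EuclideanSpace ℝ (Fin (2 * n)) :=
  mkVec fun _ => 1 / Real.sqrt (2 * n)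

/-- The block-indicator direction `v̄₂` (unit vector). -/
noncomputable def vbar2 (n : ℕ) : EuclideanSpace ℝ (Fin (2 * n)) :=
  mkVec fun i =>
    if (i : ℕ) < n then 1 / Real.sqrt (2 * n) else -(1 / Real.sqrt (2 * n))

/-- The indicator that the pair `i, j` is separated by `S`. -/
noncomputable def separated {N : ℕ} (S : Finset (Fin N)) (i j : Fin N) : ℝ :=
  if (i ∈ S ↔ j ∈ S) then 0 else 1

/-- The number of edges of the configuration leaving `S`. -/
noncomputable def cutSize {N : ℕ} (ω : Config N) (S : Finset (Fin N)) : ℝ :=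
  ∑ e : EdgeIdx N, if ω e then separated S e.1.1 e.1.2 else 0

lemma exists_minBisection (n : ℕ) (ω : Config (2 * n)) :
    ∃ S : Finset (Fin (2 * n)), S.card = n ∧
      ∀ T : Finset (Fin (2 * n)), T.card = n → cutSize ω S ≤ cutSize ω T := by
  have hne : (powersetCard n (univ : Finset (Fin (2 * n)))).Nonempty :=
    powersetCard_nonempty.2 (by simp; omega)
  obtain ⟨S, hS, hmin⟩ := exists_min_image _ (cutSize ω) hne
  exact ⟨S, (mem_powersetCard.1 hS).2,
    fun T hT => hmin T (mem_powersetCard.2 ⟨subset_univ T, hT⟩)⟩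

/-- A bisection of the vertex set cutting as few edges as possible. -/
noncomputable def minBisection (n : ℕ) (ω : Config (2 * n)) : Finset (Fin (2 * n)) :=
  (exists_minBisection n ω).choose

/-- Edge probabilities of the block model whose first block is the hidden set `T`. -/
noncomputable def plantedProb {N : ℕ} (T : Finset (Fin N)) (p q : ℝ) (i j : Fin N) : ℝ :=
  if (i ∈ T ↔ j ∈ T) then p else q

/-- `S` agrees with `T`, up to complement, outside a `γ`-fraction of either block. -/
def Recovers {n : ℕ} (γ : ℝ) (T S : Finset (Fin (2 * n))) : Prop :=
  ((1 - γ) * n ≤ ((T ∩ S).card : ℝ) ∧ (1 - γ) * n ≤ ((Tᶜ ∩ Sᶜ).card : ℝ)) ∨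
    ((1 - γ) * n ≤ ((T ∩ Sᶜ).card : ℝ) ∧ (1 - γ) * n ≤ ((Tᶜ ∩ S).card : ℝ))

lemma integral_bern {p : ℝ} (hp0 : 0 ≤ p) (hp1 : p ≤ 1) (f : Bool → ℝ) :
    ∫ x, f x ∂bern p = p * f true + (1 - p) * f false := by
  unfold bern
  rw [PMF.integral_eq_sum]
  have h : p.toNNReal ≤ 1 := Real.toNNReal_le_one.2 hp1
  simp [PMF.bernoulli_apply, min_eq_left h, hp0, NNReal.coe_sub h]

lemma two_mul_sum_edges {N : ℕ} (h : Fin N → Fin N → ℝ) (hsymm : ∀ i j, h i j = h j i)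
    (hdiag : ∀ i, h i i = 0) :
    2 * ∑ e : EdgeIdx N, h e.1.1 e.1.2 = ∑ i, ∑ j, h i j := by
  have hlt : ∑ e : EdgeIdx N, h e.1.1 e.1.2
      = ∑ i, ∑ j, if i < j then h i j else 0 := by
    rw [← Fintype.sum_prod_type' (fun i j => if i < j then h i j else 0), ← sum_filter]
    exact (sum_subtype _ (by simp) fun e : Fin N × Fin N => h e.1 e.2).symm
  have hgt : ∑ e : EdgeIdx N, h e.1.1 e.1.2
      = ∑ i, ∑ j, if j < i then h i j else 0 := by
    rw [hlt, sum_comm]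
    simp_rw [hsymm]
  rw [two_mul]
  nth_rewrite 1 [hlt]
  rw [hgt, ← sum_add_distrib]
  refine sum_congr rfl fun i _ => ?_
  rw [← sum_add_distrib]
  refine sum_congr rfl fun j _ => ?_
  rcases lt_trichotomy i j with hij | rfl | hij
  · simp [hij, hij.le]
  · simp [hdiag]
  · simp [hij, hij.le]

/-- The `±1`-valued indicator of a set. -/
noncomputable def spin {N : ℕ} (S : Finset (Fin N)) (i : Fin N) : ℝ := if i ∈ S then 1 else -1

lemma sum_spin {n : ℕ} {S : Finset (Fin (2 * n))} (hS : S.card = n) : ∑ i, spin S i = 0 := by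
  have h : ∀ i, spin S i = 2 * (if i ∈ S then 1 else 0) - 1 := by
    intro i; unfold spin; split_ifs <;> norm_num
  simp only [h, sum_sub_distrib, ← mul_sum, sum_boole]
  simp [hS]

lemma sum_spin_mul_spin {N : ℕ} (S T : Finset (Fin N)) :
    ∑ i, spin S i * spin T i = N - 2 * ((symmDiff S T).card : ℝ) := by
  have h : ∀ i, spin S i * spin T i = 1 - 2 * (if i ∈ symmDiff S T then 1 else 0) := by
    intro i; unfold spin; simp only [mem_symmDiff]
    by_cases h1 : i ∈ S <;> by_cases h2 : i ∈ T <;> simp [h1, h2] <;> norm_num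
  simp only [h, sum_sub_distrib, ← mul_sum, sum_boole]
  simp

lemma sum_edges_separated {n : ℕ} {S T : Finset (Fin (2 * n))} (hS : S.card = n)
    (hT : T.card = n) (x y : ℝ) :
    ∑ e : EdgeIdx (2 * n),
        (x * (separated S e.1.1 e.1.2 * (1 - separated T e.1.1 e.1.2))
          + y * (separated T e.1.1 e.1.2 * (1 - separated S e.1.1 e.1.2)))
      = (x + y) * ((symmDiff S T).card * (2 * n - (symmDiff S T).card) / 2) := by
  have hsymm : ∀ (U : Finset (Fin (2 * n))) i j, separated U i j = separated U j i := by
    intro U i j; simp [separated, iff_comm]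
  have hspin : ∀ (U : Finset (Fin (2 * n))) i j,
      separated U i j = (1 - spin U i * spin U j) / 2 := by
    intro U i j; unfold separated spin
    by_cases h1 : i ∈ U <;> by_cases h2 : j ∈ U <;> simp [h1, h2]
  have key := two_mul_sum_edges
    (fun i j => x * (separated S i j * (1 - separated T i j))
          + y * (separated T i j * (1 - separated S i j)))
    (fun i j => by simp only [hsymm S i j, hsymm T i j]) (fun i => by simp [separated])
  have hexp : ∀ i j, x * (separated S i j * (1 - separated T i j))
          + y * (separated T i j * (1 - separated S i j))
      = (x + y) / 4 - (x + y) / 4 * ((spin S i * spin T i) * (spin S j * spin T j))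
        + (y - x) / 4 * (spin S i * spin S j) + (x - y) / 4 * (spin T i * spin T j) := by
    intro i j; rw [hspin, hspin]; ring
  have hsum : ∑ i, ∑ j, (x * (separated S i j * (1 - separated T i j))
          + y * (separated T i j * (1 - separated S i j)))
      = (x + y) * ((symmDiff S T).card * (2 * n - (symmDiff S T).card)) := by
    simp_rw [hexp, sum_add_distrib, sum_sub_distrib, ← mul_sum, ← sum_mul, sum_spin hS,
      sum_spin hT, sum_spin_mul_spin]
    simp
    ring
  linarith

/-- Chernoff bound: another bisection rarely beats the hidden one. -/
lemma measureReal_cutSize_le {n : ℕ} {S T : Finset (Fin (2 * n))} (hS : S.card = n)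
    (hT : T.card = n) {a b : ℝ} (hb : 0 < b) (hab : b ≤ a) (han : a ≤ n) :
    (genMeasure (plantedProb T (a / n) (b / n))).real {ω | cutSize ω S ≤ cutSize ω T}
      ≤ Real.exp (-((√a - √b) ^ 2
          * ((symmDiff S T).card * (2 * n - (symmDiff S T).card) / (2 * n)))) := by
  have ha : 0 < a := hb.trans_le hab
  have hn : (0 : ℝ) < n := ha.trans_le han
  set s : ℝ := √a / √b with hs
  have hsa : 0 < √a := Real.sqrt_pos.2 ha
  have hsb : 0 < √b := Real.sqrt_pos.2 hb
  have hs0 : 0 < s := div_pos hsa hsb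
  have hs1 : 1 ≤ s := (one_le_div hsb).2 (Real.sqrt_le_sqrt hab)
  set t : ℝ := Real.log s with ht
  have ht0 : 0 ≤ t := Real.log_nonneg hs1
  set c : EdgeIdx (2 * n) → ℝ :=
    fun e => separated T e.1.1 e.1.2 - separated S e.1.1 e.1.2 with hc
  set p : EdgeIdx (2 * n) → ℝ := fun e => plantedProb T (a / n) (b / n) e.1.1 e.1.2 with hp
  have hp01 : ∀ e, 0 ≤ p e ∧ p e ≤ 1 := by
    intro e
    simp only [hp, plantedProb]
    split_ifs
    · exact ⟨by positivity, (div_le_one hn).2 han⟩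
    · exact ⟨by positivity, (div_le_one hn).2 (hab.trans han)⟩
  set f : EdgeIdx (2 * n) → Bool → ℝ := fun e x => if x then Real.exp (t * c e) else 1 with hf
  have hF : ∀ ω : Config (2 * n),
      ∏ e, f e (ω e) = Real.exp (t * (cutSize ω T - cutSize ω S)) := by
    intro ω
    rw [cutSize, cutSize, ← sum_sub_distrib, mul_sum, Real.exp_sum]
    refine prod_congr rfl fun e _ => ?_
    by_cases h : ω e <;> simp [hf, hc, h]
  have hμ : IsProbabilityMeasure (genMeasure (plantedProb T (a / n) (b / n))) := by
    unfold genMeasure; infer_instance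
  calc (genMeasure (plantedProb T (a / n) (b / n))).real {ω | cutSize ω S ≤ cutSize ω T}
      ≤ (genMeasure (plantedProb T (a / n) (b / n))).real {ω | 1 ≤ ∏ e, f e (ω e)} := by
        refine measureReal_mono fun ω hω => ?_
        simp only [Set.mem_ofPred_eq] at hω ⊢
        rw [hF]
        exact Real.one_le_exp (mul_nonneg ht0 (sub_nonneg.2 hω))
    _ ≤ ∫ ω, ∏ e, f e (ω e) ∂genMeasure (plantedProb T (a / n) (b / n)) := by
        have := mul_meas_ge_le_integral_of_nonneg
          (μ := genMeasure (plantedProb T (a / n) (b / n))) (f := fun ω => ∏ e, f e (ω e))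
          (Eventually.of_forall fun ω => by simp only [hF]; positivity)
          (Integrable.of_finite) 1
        simpa using this
    _ = ∏ e, ∫ x, f e x ∂bern (p e) := integral_fintype_prod_eq_prod f
    _ ≤ ∏ e, Real.exp (p e * (Real.exp (t * c e) - 1)) := by
        refine prod_le_prod (fun e _ => integral_nonneg fun x => ?_) fun e _ => ?_
        · simp only [hf]; split_ifs <;> positivity
        · rw [integral_bern (hp01 e).1 (hp01 e).2]
          have := Real.add_one_le_exp (p e * (Real.exp (t * c e) - 1))
          simp only [hf, if_true, Bool.false_eq_true, if_false]
          linarith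
    _ = Real.exp (-((√a - √b) ^ 2
          * ((symmDiff S T).card * (2 * n - (symmDiff S T).card) / (2 * n)))) := by
        rw [← Real.exp_sum]
        congr 1
        have hes : Real.exp t = s := Real.exp_log hs0
        have hterm : ∀ e, p e * (Real.exp (t * c e) - 1)
            = (a / n * (s⁻¹ - 1)) * (separated S e.1.1 e.1.2 * (1 - separated T e.1.1 e.1.2))
              + (b / n * (s - 1)) * (separated T e.1.1 e.1.2 * (1 - separated S e.1.1 e.1.2)) := by
          intro e
          simp only [hp, hc, plantedProb, separated]
          split_ifs <;> simp [Real.exp_neg, hes]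
        simp_rw [hterm]
        rw [sum_edges_separated hS hT]
        have h1 : a * s⁻¹ = √a * √b := by
          rw [hs, inv_div]
          nth_rewrite 1 [← Real.mul_self_sqrt ha.le]
          field_simp
        have h2 : b * s = √a * √b := by
          rw [hs]
          nth_rewrite 1 [← Real.mul_self_sqrt hb.le]
          field_simp
        have h3 : a / n * (s⁻¹ - 1) + b / n * (s - 1) = -((√a - √b) ^ 2) / n := by
          have h4 : (√a - √b) ^ 2 = a + b - 2 * (√a * √b) := by
            rw [sub_sq, Real.sq_sqrt ha.le, Real.sq_sqrt hb.le]; ring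
          rw [h4]
          linear_combination (h1 + h2) / n
        rw [h3]
        field_simp

lemma sum_pow_card_symmDiff {N : ℕ} (T : Finset (Fin N)) (x : ℝ) :
    ∑ S : Finset (Fin N), x ^ (symmDiff S T).card = (1 + x) ^ N := by
  have h := Equiv.sum_comp (symmDiff_left_involutive T).toPerm
    (fun S : Finset (Fin N) => x ^ S.card)
  rw [Function.Involutive.coe_toPerm] at h
  rw [h]
  simpa [add_comm] using Fintype.sum_pow_mul_eq_add_pow (Fin N) x 1

lemma recovers_of_card_symmDiff_le {n : ℕ} {S T : Finset (Fin (2 * n))} (hS : S.card = n)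
    (hT : T.card = n) {γ : ℝ}
    (h : ((symmDiff S T).card : ℝ) ≤ 2 * γ * n ∨ 2 * n - ((symmDiff S T).card : ℝ) ≤ 2 * γ * n) :
    Recovers γ T S := by
  have e1 : (T ∩ S).card + (T ∩ Sᶜ).card = n := by
    rw [← sdiff_eq_inter_compl, card_inter_add_card_sdiff, hT]
  have e2 : (T ∩ S).card + (Tᶜ ∩ S).card = n := by
    rw [inter_comm T S, inter_comm Tᶜ, ← sdiff_eq_inter_compl, card_inter_add_card_sdiff, hS]
  have e3 : (Tᶜ ∩ S).card + (Tᶜ ∩ Sᶜ).card = n := by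
    rw [← sdiff_eq_inter_compl, card_inter_add_card_sdiff, card_compl, hT, Fintype.card_fin]
    omega
  have e4 : (symmDiff S T).card = (Tᶜ ∩ S).card + (T ∩ Sᶜ).card := by
    rw [symmDiff_def, sup_eq_union, card_union_of_disjoint disjoint_sdiff_sdiff,
      sdiff_eq_inter_compl, sdiff_eq_inter_compl, inter_comm S]
  rify at e1 e2 e3 e4
  rw [e4] at h
  rcases h with h | h
  · left; constructor <;> linarith
  · right; constructor <;> linarith

/-- Union bound over all bisections far from the hidden one. -/
theorem measureReal_minBisection_not_recovers_le {n : ℕ} {T : Finset (Fin (2 * n))}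
    (hT : T.card = n) {a b γ : ℝ} (hb : 0 < b) (hab : b ≤ a) (han : a ≤ n) (hγ : 0 < γ)
    (hsep : 2 * Real.log (1 / γ) ≤ (√a - √b) ^ 2) :
    (genMeasure (plantedProb T (a / n) (b / n))).real {ω | ¬ Recovers γ T (minBisection n ω)}
      ≤ 2 * Real.exp (-(((√a - √b) ^ 2 - 2 * Real.log (1 / γ) - 2) * γ * n)) := by
  have hn : (0 : ℝ) < n := hb.trans_le (hab.trans han)
  set δ := (√a - √b) ^ 2 with hδ
  set L := Real.log (1 / γ) with hL
  have hδ0 : 0 ≤ δ := sq_nonneg _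
  set r : ℝ := Real.exp (-((δ - 2 * L) * γ * n)) with hr
  have hγpow : ∀ m : ℕ, γ ^ m = Real.exp (-(L * m)) := by
    intro m
    rw [hL, one_div, Real.log_inv, neg_mul, neg_neg, mul_comm, Real.exp_nat_mul,
      Real.exp_log hγ]
  set far := univ.filter fun S : Finset (Fin (2 * n)) => S.card = n ∧
    2 * γ * n < ((symmDiff S T).card : ℝ) ∧ 2 * γ * n < ((symmDiff S Tᶜ).card : ℝ)
  have hcompl : ∀ S : Finset (Fin (2 * n)),
      ((symmDiff S Tᶜ).card : ℝ) = 2 * n - (symmDiff S T).card := by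
    intro S
    have h1 : symmDiff S Tᶜ = (symmDiff S T)ᶜ := by
      ext i; simp only [mem_symmDiff, mem_compl]; tauto
    have h2 := card_add_card_compl (symmDiff S T)
    rw [Fintype.card_fin] at h2
    rw [h1]
    rify at h2
    linarith
  have hμ : IsProbabilityMeasure (genMeasure (plantedProb T (a / n) (b / n))) := by
    unfold genMeasure; infer_instance
  have hdecay : ∀ m m' : ℝ, 2 * γ * n < m → m ≤ m' → m + m' = 2 * n →
      Real.exp (-(δ * (m * m' / (2 * n)))) ≤ r * Real.exp (-(L * m)) := by
    intro m m' hm hmm hsum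
    rw [hr, ← Real.exp_add, Real.exp_le_exp]
    have hm0 : 0 < m := lt_trans (by positivity) hm
    have h1 : m / 2 ≤ m * m' / (2 * n) := by
      rw [div_le_div_iff₀ (by norm_num) (by positivity)]
      nlinarith
    have h2 := mul_le_mul_of_nonneg_left h1 hδ0
    have h3 := mul_le_mul_of_nonneg_left hm.le (sub_nonneg.2 hsep)
    nlinarith
  have hterm : ∀ S ∈ far,
      (genMeasure (plantedProb T (a / n) (b / n))).real {ω | cutSize ω S ≤ cutSize ω T}
        ≤ r * (γ ^ (symmDiff S T).card + γ ^ (symmDiff S Tᶜ).card) := by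
    intro S hSfar
    obtain ⟨hS, h1, h2⟩ := (mem_filter.1 hSfar).2
    refine (measureReal_cutSize_le hS hT hb hab han).trans ?_
    rw [← hcompl, hγpow, hγpow, mul_add, ← hδ]
    have hc := hcompl S
    rcases le_total ((symmDiff S T).card : ℝ) ((symmDiff S Tᶜ).card : ℝ) with h | h
    · have := hdecay _ _ h1 h (by linarith)
      have : 0 ≤ r * Real.exp (-(L * (symmDiff S Tᶜ).card)) := by positivity
      linarith
    · have h3 := hdecay _ _ h2 h (by linarith)
      rw [mul_comm ((symmDiff S Tᶜ).card : ℝ)] at h3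
      have : 0 ≤ r * Real.exp (-(L * (symmDiff S T).card)) := by positivity
      linarith
  calc (genMeasure (plantedProb T (a / n) (b / n))).real {ω | ¬ Recovers γ T (minBisection n ω)}
      ≤ (genMeasure (plantedProb T (a / n) (b / n))).real
          (⋃ S ∈ far, {ω | cutSize ω S ≤ cutSize ω T}) := by
        refine measureReal_mono (fun ω hω => ?_) (measure_ne_top _ _)
        obtain ⟨hcard, hmin⟩ := (exists_minBisection n ω).choose_spec
        have hbad := mt (recovers_of_card_symmDiff_le hcard hT) hω
        push Not at hbad
        rw [Set.mem_iUnion₂]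
        exact ⟨minBisection n ω,
          mem_filter.2 ⟨mem_univ _, hcard, hbad.1, by rw [hcompl]; exact hbad.2⟩, hmin T hT⟩
    _ ≤ ∑ S ∈ far,
          (genMeasure (plantedProb T (a / n) (b / n))).real {ω | cutSize ω S ≤ cutSize ω T} :=
        measureReal_biUnion_finset_le _ _
    _ ≤ ∑ S ∈ far, r * (γ ^ (symmDiff S T).card + γ ^ (symmDiff S Tᶜ).card) :=
        sum_le_sum hterm
    _ ≤ ∑ S, r * (γ ^ (symmDiff S T).card + γ ^ (symmDiff S Tᶜ).card) :=
        sum_le_sum_of_subset_of_nonneg (subset_univ _) fun S _ _ => by positivity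
    _ = 2 * (r * (1 + γ) ^ (2 * n)) := by
        rw [← mul_sum, sum_add_distrib, sum_pow_card_symmDiff, sum_pow_card_symmDiff]
        ring
    _ ≤ 2 * (r * Real.exp γ ^ (2 * n)) := by
        gcongr
        linarith [Real.add_one_le_exp γ]
    _ = 2 * Real.exp (-((δ - 2 * L - 2) * γ * n)) := by
        rw [hr, ← Real.exp_nat_mul, ← Real.exp_add]
        congr 2
        push_cast
        ring

lemma recovers_of_half_le {n : ℕ} {S T : Finset (Fin (2 * n))} (hS : S.card = n)
    (hT : T.card = n) {γ : ℝ} (hγ : 1 / 2 ≤ γ) : Recovers γ T S := by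
  apply recovers_of_card_symmDiff_le hS hT
  have hn : (0 : ℝ) ≤ n := n.cast_nonneg
  by_contra! h
  nlinarith [h.1, h.2]

/-- Weak recovery by minimum bisection, uniformly over the hidden bisection. -/
theorem exists_forall_planted_not_recovers_le {a b γ : ℝ} (hb : 0 < b) (hab : b < a)
    (hγ : 0 < γ) (hsep : 12 * Real.log (1 / γ) ≤ (a - b) ^ 2 / (a + b)) :
    ∃ ε : ℕ → ℝ, Tendsto ε atTop (nhds 0) ∧
      ∀ᶠ n : ℕ in atTop, ∀ T : Finset (Fin (2 * n)), T.card = n →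
        (genMeasure (plantedProb T (a / n) (b / n))).real
          {ω | ¬ Recovers γ T (minBisection n ω)} ≤ ε n := by
  rcases le_or_gt (1 / 2) γ with hγ2 | hγ2
  · refine ⟨fun _ => 0, tendsto_const_nhds, Eventually.of_forall fun n T hT => ?_⟩
    have : {ω | ¬ Recovers γ T (minBisection n ω)} = ∅ :=
      Set.eq_empty_of_forall_notMem fun ω hω =>
        hω (recovers_of_half_le (exists_minBisection n ω).choose_spec.1 hT hγ2)
    rw [this, measureReal_empty]
  have ha : 0 < a := hb.trans hab
  have hlog : Real.log 2 ≤ Real.log (1 / γ) :=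
    Real.log_le_log two_pos ((le_div_iff₀ hγ).2 (by linarith))
  have hlog2 := Real.log_two_gt_d9
  have hδ : (a - b) ^ 2 / (a + b) ≤ 2 * (√a - √b) ^ 2 := by
    rw [div_le_iff₀ (by positivity)]
    have h1 := Real.sq_sqrt ha.le
    have h2 := Real.sq_sqrt hb.le
    have h3 : (a - b) ^ 2 = (√a - √b) ^ 2 * (√a + √b) ^ 2 := by
      rw [← mul_pow, mul_comm, ← sq_sub_sq, h1, h2]
    rw [h3]
    have h4 : (√a + √b) ^ 2 ≤ 2 * (a + b) := by nlinarith [sq_nonneg (√a - √b)]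
    nlinarith [mul_le_mul_of_nonneg_left h4 (sq_nonneg (√a - √b))]
  have hrate : 0 < ((√a - √b) ^ 2 - 2 * Real.log (1 / γ) - 2) * γ :=
    mul_pos (by linarith) hγ
  refine ⟨fun n => 2 * Real.exp (-(((√a - √b) ^ 2 - 2 * Real.log (1 / γ) - 2) * γ * n)), ?_, ?_⟩
  · have h := Real.tendsto_exp_neg_atTop_nhds_zero.comp
      (tendsto_natCast_atTop_atTop.const_mul_atTop hrate)
    simpa using h.const_mul 2
  · filter_upwards [eventually_ge_atTop ⌈a⌉₊] with n hn T hT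
    exact measureReal_minBisection_not_recovers_le hT hb hab.le (Nat.ceil_le.1 hn) hγ
      (by linarith)

lemma card_block1 (n : ℕ) : (block1 n).card = n := by
  have h := Fin.card_filter_val_lt (m := n) (n := 2 * n)
  rw [block1]
  simpa [two_mul] using h

lemma block2_eq_compl (n : ℕ) : block2 n = (block1 n)ᶜ := by
  ext i; simp [block1, block2]

lemma sbm2_eq_genMeasure (n : ℕ) (a b : ℝ) :
    sbm2 n a b = genMeasure (plantedProb (block1 n) (a / n) (b / n)) := by
  simp [sbm2, genMeasure, plantedProb, block1]

/-- Theorem 1.2 / `thm:main1`: there are absolute constants `C₀, C₁`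
such that whenever `a > b > C₀`, `γ > 0` and `(a-b)²/(a+b) ≥ C₁ log(1/γ)`, there is an
estimator that, on a graph drawn from `SBM(n,a,b)`, outputs a `γ`-correct partition
(up to the labelling of the two blocks) with probability `1 - o(1)` as `n → ∞`. -/
theorem sbm_gamma_correct_recovery :
    ∃ C₀ C₁ : ℝ, ∀ a b γ : ℝ, C₀ < b → b < a → 0 < γ →
      C₁ * Real.log (1 / γ) ≤ (a - b) ^ 2 / (a + b) →
      ∃ est : (n : ℕ) → Config (2 * n) → Finset (Fin (2 * n)) × Finset (Fin (2 * n)),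
        (∀ n ω, isPartition2 (est n ω)) ∧
        Tendsto
          (fun n => sbm2 n a b
            {ω | correct2 n γ (est n ω) ∨ correct2 n γ (est n ω).swap})
          atTop (nhds 1) := by
  refine ⟨0, 12, fun a b γ hb hab hγ hsep =>
    ⟨fun n ω => (minBisection n ω, (minBisection n ω)ᶜ),
      fun n ω => ⟨disjoint_compl_right, union_compl _⟩, ?_⟩⟩
  obtain ⟨ε, hε, hbound⟩ := exists_forall_planted_not_recovers_le hb hab hγ hsep
  have hμ : ∀ n, IsProbabilityMeasure (sbm2 n a b) := fun n => by
    unfold sbm2; infer_instance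
  have hset : ∀ n, {ω | correct2 n γ (minBisection n ω, (minBisection n ω)ᶜ) ∨
      correct2 n γ (minBisection n ω, (minBisection n ω)ᶜ).swap}
      = {ω | ¬ Recovers γ (block1 n) (minBisection n ω)}ᶜ := by
    intro n
    ext ω
    simp only [Set.mem_compl_iff, Set.mem_ofPred_eq, not_not, correct2, Recovers,
      block2_eq_compl, Prod.swap]
  have hreal : Tendsto (fun n => (sbm2 n a b).real
      {ω | ¬ Recovers γ (block1 n) (minBisection n ω)}) atTop (nhds 0) := by
    refine squeeze_zero' (Eventually.of_forall fun n => measureReal_nonneg) ?_ hε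
    filter_upwards [hbound] with n hn
    rw [sbm2_eq_genMeasure]
    exact hn _ (card_block1 n)
  have hgood : Tendsto (fun n => (sbm2 n a b).real
      {ω | ¬ Recovers γ (block1 n) (minBisection n ω)}ᶜ) atTop (nhds 1) := by
    have h := (tendsto_const_nhds (x := (1 : ℝ))).sub hreal
    rw [sub_zero] at h
    refine h.congr fun n => ?_
    rw [probReal_compl_eq_one_sub MeasurableSet.of_discrete]
  simp_rw [hset]
  have h := ENNReal.tendsto_ofReal hgood
  simpa [ofReal_measureReal] using h
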